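/- Let H be an ordered graph on h vertices with interval chromatic number χ<(H)=2 satisfying: (i) the vertices 1 and ⌈h/2⌉ are isolated in H; (ii) every edge of H lies between the intervals [2, ⌈h/2⌉−1] and [⌈h/2⌉+1, h]; (iii) 1 ≤ s(H) < ⌈h/2⌉ and the interval [s(H), h−1] is an independent set in H. There exists η₀>0 (depending on h) such that for every η with 0<η≤η₀ there exist n₀∈ℕ and ξ>0 with the following property. Set s := 2(⌈h/2⌉ − s(H)). If G is an ordered graph on vertex set [n] with n ≥ n₀ and minimum degree δ(G) ≥ ηn, then for every pair x,y ∈ [n] there are at least ξn^{sh−1} sets X ⊆ [n]∖{x,y} of size sh−1 such that both G[X∪{x}] and G[X∪{y}] contain perfect H-tilings. -/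

import Mathlib

open Finset

section Defs

variable {h n : ℕ}

/-- `φ` is an order-preserving embedding of the ordered graph `H` into the ordered graph `G`:
a strictly increasing map carrying edges of `H` to edges of `G`. -/
def IsOrderedCopy (H : SimpleGraph (Fin h)) (G : SimpleGraph (Fin n))
    (φ : Fin h → Fin n) : Prop :=
  StrictMono φ ∧ ∀ i j : Fin h, H.Adj i j → G.Adj (φ i) (φ j)

/-- `S` is the vertex set of a copy of the ordered graph `H` in the ordered graph `G`. -/
def IsCopySet (H : SimpleGraph (Fin h)) (G : SimpleGraph (Fin n))
    (S : Finset (Fin n)) : Prop :=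
  ∃ φ : Fin h → Fin n, IsOrderedCopy H G φ ∧ Finset.image φ Finset.univ = S

/-- `G` has an `H`-tiling (vertex-disjoint copies of `H`) whose copies exactly cover the
vertex set `S`; equivalently, the induced ordered subgraph `G[S]` has a perfect `H`-tiling. -/
def HasPerfectTilingOn (H : SimpleGraph (Fin h)) (G : SimpleGraph (Fin n))
    (S : Finset (Fin n)) : Prop :=
  ∃ 𝒯 : Finset (Finset (Fin n)),
    (∀ T ∈ 𝒯, IsCopySet H G T) ∧
    (𝒯 : Set (Finset (Fin n))).PairwiseDisjoint id ∧
    𝒯.biUnion id = S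

/-- `G` has a perfect `H`-tiling. -/
def HasPerfectTiling (H : SimpleGraph (Fin h)) (G : SimpleGraph (Fin n)) : Prop :=
  HasPerfectTilingOn H G Finset.univ

/-- The degree of a vertex in an ordered graph. -/
noncomputable def odeg (G : SimpleGraph (Fin n)) (v : Fin n) : ℕ :=
  (G.neighborSet v).ncard

/-- `[h]` can be partitioned into `k` intervals, each independent in `H`
(expressed via a monotone colouring with independent fibres). -/
def HasIntervalColoring (H : SimpleGraph (Fin h)) (k : ℕ) : Prop :=
  ∃ c : Fin h → Fin k, Monotone c ∧ ∀ i j : Fin h, H.Adj i j → c i ≠ c j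

/-- The interval chromatic number `χ<(H)` of an ordered graph. -/
noncomputable def intervalChi (H : SimpleGraph (Fin h)) : ℕ :=
  sInf {k | HasIntervalColoring H k}

/-- `α⁺ᵢ(H)`: `α⁺₀ = 0`, and `α⁺_{i+1}` is the largest `k ≤ h` such that the interval
`[α⁺ᵢ + 1, k]` is independent in `H` (vertices are 1-indexed via `v ↦ (v : ℕ) + 1`). -/
noncomputable def alphaPlus (H : SimpleGraph (Fin h)) : ℕ → ℕ
  | 0 => 0
  | (i + 1) => sSup {k | k ≤ h ∧ ∀ a b : Fin h,
      alphaPlus H i + 1 ≤ (a : ℕ) + 1 → (a : ℕ) + 1 ≤ k →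
      alphaPlus H i + 1 ≤ (b : ℕ) + 1 → (b : ℕ) + 1 ≤ k → ¬ H.Adj a b}

/-- `α⁻ᵢ(H)`: `α⁻₀ = h + 1`, and `α⁻_{i+1}` is the smallest `k ≥ 1` such that the interval
`[k, α⁻ᵢ − 1]` is independent in `H`. -/
noncomputable def alphaMinus (H : SimpleGraph (Fin h)) : ℕ → ℕ
  | 0 => h + 1
  | (i + 1) => sInf {k | 1 ≤ k ∧ ∀ a b : Fin h,
      k ≤ (a : ℕ) + 1 → (a : ℕ) + 1 ≤ alphaMinus H i - 1 →
      k ≤ (b : ℕ) + 1 → (b : ℕ) + 1 ≤ alphaMinus H i - 1 → ¬ H.Adj a b}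

/-- `α*(H) = min over 1 ≤ ℓ < χ<(H) of min{α⁺_ℓ/(ℓh), (h − α⁻_ℓ + 1)/(ℓh)}`. -/
noncomputable def alphaStar (H : SimpleGraph (Fin h)) : ℝ :=
  sInf {x : ℝ | ∃ ℓ : ℕ, 1 ≤ ℓ ∧ ℓ < intervalChi H ∧
    (x = (alphaPlus H ℓ : ℝ) / (ℓ * h) ∨
     x = ((h : ℝ) - alphaMinus H ℓ + 1) / (ℓ * h))}

/-- `α*(H)` for ordered graphs with interval chromatic number 2:
`min{α⁺₁(H)/h, (h − α⁻₁(H) + 1)/h}`. -/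
noncomputable def alphaStar2 (H : SimpleGraph (Fin h)) : ℝ :=
  min ((alphaPlus H 1 : ℝ) / h) (((h : ℝ) - alphaMinus H 1 + 1) / h)

/-- Property A: no edges of `H` within `[1, ⌊h/2⌋ + 1]` nor within `[⌈h/2⌉, h]`. -/
def PropertyA (H : SimpleGraph (Fin h)) : Prop :=
  (∀ a b : Fin h, (a : ℕ) + 1 ≤ h / 2 + 1 → (b : ℕ) + 1 ≤ h / 2 + 1 → ¬ H.Adj a b) ∧
  (∀ a b : Fin h, (h + 1) / 2 ≤ (a : ℕ) + 1 → (h + 1) / 2 ≤ (b : ℕ) + 1 → ¬ H.Adj a b)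

/-- Property B: for each partition of `[h]` into nonempty intervals `[1, i], [i+1, h]`
there is an edge of `H` between them. -/
def PropertyB (H : SimpleGraph (Fin h)) : Prop :=
  ∀ i : ℕ, 1 ≤ i → i < h →
    ∃ a b : Fin h, H.Adj a b ∧ (a : ℕ) + 1 ≤ i ∧ i + 1 ≤ (b : ℕ) + 1

/-- `s(H)`: the smallest vertex adjacent to `h`, and `0` if `h` is isolated. -/
noncomputable def sOG (H : SimpleGraph (Fin h)) : ℕ :=
  sInf {k | ∃ a b : Fin h, H.Adj a b ∧ (a : ℕ) + 1 = k ∧ (b : ℕ) + 1 = h}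

open Classical in
/-- `l(H)`: the largest vertex adjacent to `1`, and `h + 1` if `1` is isolated. -/
noncomputable def lOG (H : SimpleGraph (Fin h)) : ℕ :=
  if ∃ a b : Fin h, H.Adj a b ∧ (a : ℕ) + 1 = 1 then
    sSup {k | ∃ a b : Fin h, H.Adj a b ∧ (a : ℕ) + 1 = 1 ∧ (b : ℕ) + 1 = k}
  else h + 1

/-- The vertex `h` has Property C: `s(H) ≥ 1` and there is an edge within `[s(H), h − 1]`. -/
def PropertyCLast (H : SimpleGraph (Fin h)) : Prop :=
  1 ≤ sOG H ∧ ∃ a b : Fin h, H.Adj a b ∧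
    sOG H ≤ (a : ℕ) + 1 ∧ (a : ℕ) + 1 ≤ h - 1 ∧
    sOG H ≤ (b : ℕ) + 1 ∧ (b : ℕ) + 1 ≤ h - 1

/-- The vertex `1` has Property C: `l(H) ≤ h` and there is an edge within `[2, l(H)]`. -/
def PropertyCFirst (H : SimpleGraph (Fin h)) : Prop :=
  lOG H ≤ h ∧ ∃ a b : Fin h, H.Adj a b ∧
    2 ≤ (a : ℕ) + 1 ∧ (a : ℕ) + 1 ≤ lOG H ∧
    2 ≤ (b : ℕ) + 1 ∧ (b : ℕ) + 1 ≤ lOG H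

/-- `S` is an `H`-absorbing set for `W`: both `G[S]` and `G[S ∪ W]` have perfect `H`-tilings. -/
def IsAbsorbingFor (H : SimpleGraph (Fin h)) (G : SimpleGraph (Fin n))
    (S W : Finset (Fin n)) : Prop :=
  HasPerfectTilingOn H G S ∧ HasPerfectTilingOn H G (S ∪ W)

end Defs

section Regularity

/-- The density `d(A,B) = e(A,B)/(|A||B|)` of a pair of vertex sets in a graph. -/
noncomputable def pairDensity {V : Type*} (G : SimpleGraph V) (A B : Finset V) : ℝ :=
  ({e : V × V | e.1 ∈ A ∧ e.2 ∈ B ∧ G.Adj e.1 e.2}.ncard : ℝ) /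
    ((A.card : ℝ) * (B.card : ℝ))

/-- The pair `(A, B)` is `ε`-regular in `G`. -/
def IsRegularPair {V : Type*} (G : SimpleGraph V) (A B : Finset V) (ε : ℝ) : Prop :=
  ∀ X ⊆ A, ∀ Y ⊆ B, ε * A.card ≤ (X.card : ℝ) → ε * B.card ≤ (Y.card : ℝ) →
    |pairDensity G A B - pairDensity G X Y| < ε

end Regularity

section Bottle

/-- The chromatic number of a finite graph. -/
noncomputable def chromNum {m : ℕ} (B : SimpleGraph (Fin m)) : ℕ :=
  sInf {k | ∃ c : Fin m → Fin k, ∀ x y : Fin m, B.Adj x y → c x ≠ c y}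

/-- `σ(B)`: the smallest size of a colour class in any proper colouring of `B`
with `χ(B)` colours. -/
noncomputable def sigmaMinCl {m : ℕ} (B : SimpleGraph (Fin m)) : ℕ :=
  sInf {c | ∃ C : Fin m → Fin (chromNum B),
    (∀ x y : Fin m, B.Adj x y → C x ≠ C y) ∧
    ∃ i : Fin (chromNum B), c = (Finset.univ.filter (fun v => C v = i)).card}

/-- The critical chromatic number `χ_cr(B) = (χ(B) − 1)·|B|/(|B| − σ(B))`. -/
noncomputable def critChrom {m : ℕ} (B : SimpleGraph (Fin m)) : ℝ :=
  ((chromNum B : ℝ) - 1) * m / ((m : ℝ) - sigmaMinCl B)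

/-- `φ` is an interval labeling of the complete multipartite graph with part function `p`
(with respect to some permutation `σ` of the parts). -/
def IsIntervalLabeling {m k : ℕ} (p : Fin m → Fin k) (φ : Equiv.Perm (Fin m)) : Prop :=
  ∃ σ : Equiv.Perm (Fin k), ∀ x y : Fin m, σ (p x) < σ (p y) → φ x < φ y

/-- `G` is (an isomorphic realisation of) the ordered blow-up `(B(t), φ)` of the complete
multipartite graph `B` with part function `p`: there is a block assignment `β` whose fibres
all have size `t`, compatible with the order induced by `φ`, with adjacency between blocks
given by `B`. -/
def IsOrderedBlowup {m k : ℕ} (p : Fin m → Fin k) (φ : Equiv.Perm (Fin m)) (t : ℕ)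
    {N : ℕ} (G : SimpleGraph (Fin N)) : Prop :=
  ∃ β : Fin N → Fin m,
    (∀ x : Fin m, {u : Fin N | β u = x}.ncard = t) ∧
    (∀ u v : Fin N, u ≤ v → φ (β u) ≤ φ (β v)) ∧
    (∀ u v : Fin N, G.Adj u v ↔ p (β u) ≠ p (β v))

/-- The complete multipartite graph with part function `p` is a bottlegraph assigned to `H`:
for every interval labeling `φ` there is a `t ≥ 1` such that the ordered blow-up `(B(t), φ)`
has a perfect `H`-tiling. -/
def IsBottlegraph {h m k : ℕ} (H : SimpleGraph (Fin h)) (p : Fin m → Fin k) : Prop :=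
  ∀ φ : Equiv.Perm (Fin m), IsIntervalLabeling p φ →
    ∃ t : ℕ, 0 < t ∧ ∀ (N : ℕ) (G : SimpleGraph (Fin N)),
      IsOrderedBlowup p φ t G → HasPerfectTiling H G

end Bottle

section Counting

/-- Power mean inequality over `ℕ`. -/
lemma sum_pow_mul_card_le {ι : Type*} (s : Finset ι) (f : ι → ℕ) (q : ℕ) :
    (∑ i ∈ s, f i) ^ q * #s ≤ #s ^ q * ∑ i ∈ s, f i ^ q := by
  cases q with
  | zero => simp
  | succ q =>
    have := pow_sum_le_card_mul_sum_pow (s := s) (f := f) (fun _ _ => Nat.zero_le _) q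
    calc _ ≤ (#s ^ q * ∑ i ∈ s, f i ^ (q + 1)) * #s := Nat.mul_le_mul_right _ this
      _ = _ := by ring

/-- A bipartite relation contains many ordered bicliques. -/
lemma card_pow_mul_le_card_biclique {α : Type*} [Fintype α] [DecidableEq α]
    (R : Finset (α × α)) (p q : ℕ) :
    #R ^ (p * q) * Fintype.card α ^ (p + q) ≤
      #{F : (Fin p → α) × (Fin q → α) | ∀ i j, (F.1 i, F.2 j) ∈ R} *
        Fintype.card α ^ (2 * (p * q)) := by
  set n := Fintype.card α
  set M := #{F : (Fin p → α) × α | ∀ i, (F.1 i, F.2) ∈ R} with hM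
  have h₁ : #R ^ p * n ≤ n ^ p * M := by
    have hR : #R = ∑ w : α, #{v : α | (v, w) ∈ R} := by
      rw [Finset.card_eq_sum_card_fiberwise (f := Prod.snd) (t := univ) (by simp)]
      refine Finset.sum_congr rfl fun w _ => ?_
      refine Finset.card_bij' (fun e _ => e.1) (fun v _ => (v, w)) ?_ ?_ ?_ ?_ <;>
        simp +contextual
      rintro a b hab rfl
      exact hab
    have hM' : M = ∑ w : α, #{v : α | (v, w) ∈ R} ^ p := by
      rw [hM, Finset.card_eq_sum_card_fiberwise (f := Prod.snd) (t := univ) (by simp)]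
      refine Finset.sum_congr rfl fun w _ => ?_
      have : #{v : α | (v, w) ∈ R} ^ p =
          #(Fintype.piFinset fun _ : Fin p => ({v : α | (v, w) ∈ R} : Finset α)) := by simp
      rw [this]
      refine Finset.card_bij' (fun e _ => e.1) (fun v _ => (v, w)) ?_ ?_ ?_ ?_ <;>
        simp +contextual
      rintro a b hab rfl
      exact hab
    rw [hR, hM']
    simpa [n] using sum_pow_mul_card_le univ (fun w : α => #{v : α | (v, w) ∈ R}) p
  have h₂ : M ^ q * n ^ p ≤ (n ^ p) ^ q *
      #{F : (Fin p → α) × (Fin q → α) | ∀ i j, (F.1 i, F.2 j) ∈ R} := by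
    have hM' : M = ∑ f : Fin p → α, #{w : α | ∀ i, (f i, w) ∈ R} := by
      rw [hM, Finset.card_eq_sum_card_fiberwise (f := Prod.fst) (t := univ) (by simp)]
      refine Finset.sum_congr rfl fun w _ => ?_
      refine Finset.card_bij' (fun e _ => e.2) (fun v _ => (w, v)) ?_ ?_ ?_ ?_ <;>
        simp +contextual
      rintro a b hab rfl
      exact hab
    have hC : #{F : (Fin p → α) × (Fin q → α) | ∀ i j, (F.1 i, F.2 j) ∈ R} =
        ∑ f : Fin p → α, #{w : α | ∀ i, (f i, w) ∈ R} ^ q := by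
      rw [Finset.card_eq_sum_card_fiberwise (f := Prod.fst) (t := univ) (by simp)]
      refine Finset.sum_congr rfl fun f _ => ?_
      have : #{w : α | ∀ i, (f i, w) ∈ R} ^ q =
          #(Fintype.piFinset fun _ : Fin q => ({w : α | ∀ i, (f i, w) ∈ R} : Finset α)) := by
        simp
      rw [this]
      refine Finset.card_bij' (fun e _ => e.2) (fun v _ => (f, v)) ?_ ?_ ?_ ?_ <;>
        simp +contextual
      rintro a b hab rfl i j
      exact hab j i
    rw [hC, hM']
    simpa [n] using
      sum_pow_mul_card_le univ (fun f : Fin p → α => #{w : α | ∀ i, (f i, w) ∈ R}) q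
  set C := #{F : (Fin p → α) × (Fin q → α) | ∀ i j, (F.1 i, F.2 j) ∈ R}
  calc #R ^ (p * q) * n ^ (p + q) = (#R ^ p * n) ^ q * n ^ p := by ring
    _ ≤ (n ^ p * M) ^ q * n ^ p := by gcongr
    _ = (n ^ p) ^ q * (M ^ q * n ^ p) := by ring
    _ ≤ (n ^ p) ^ q * ((n ^ p) ^ q * C) := by gcongr
    _ = _ := by ring

/-- Counting edges from a minimum-degree condition. -/
lemma card_mul_le_card_adj {V : Type*} [DecidableEq V] (G : SimpleGraph V) [DecidableRel G.Adj]
    (D W : Finset V) (c : ℕ) (hc : ∀ w ∈ D, c ≤ #{v ∈ W | G.Adj w v}) :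
    #D * c ≤ #{e ∈ D ×ˢ W | G.Adj e.1 e.2} := by
  rw [Finset.card_eq_sum_card_fiberwise (f := Prod.fst) (t := D)
    (by intro e he; simp at he; simpa using he.1.1)]
  rw [← smul_eq_mul]
  refine Finset.card_nsmul_le_sum _ _ _ fun w hw => (hc w hw).trans ?_
  refine Finset.card_le_card_of_injOn (fun v => (w, v)) ?_ ?_
  · intro v hv
    simp at hv
    simp [hw, hv]
  · intro a _ b _ hab
    simpa using hab

/-- The functions on a `K`-element type that are injective and avoid `x` and `y`. -/
lemma pow_le_card_injective_avoiding {ι : Type*} [Fintype ι] [DecidableEq ι] {n : ℕ}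
    (x y : Fin n) :
    (n - (Fintype.card ι + 1)) ^ Fintype.card ι ≤
      #{F : ι → Fin n | Function.Injective F ∧ ∀ i, F i ≠ x ∧ F i ≠ y} := by
  classical
  set S : Finset (Fin n) := {v | v ≠ x ∧ v ≠ y} with hS
  have hcard : n ≤ #S + 2 := by
    have h1 : S = univ \ {x, y} := by
      ext v; simp [hS]
    have h2 := Finset.le_card_sdiff {x, y} (univ : Finset (Fin n))
    have h3 : #({x, y} : Finset (Fin n)) ≤ 2 := Finset.card_le_two
    rw [← h1, Finset.card_univ, Fintype.card_fin] at h2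
    omega
  calc (n - (Fintype.card ι + 1)) ^ Fintype.card ι
      ≤ (#S + 1 - Fintype.card ι) ^ Fintype.card ι := Nat.pow_le_pow_left (by omega) _
    _ ≤ (#S).descFactorial (Fintype.card ι) := Nat.pow_sub_le_descFactorial _ _
    _ = Fintype.card (ι ↪ S) := by simp [Fintype.card_embedding_eq]
    _ = #(univ : Finset (ι ↪ S)) := rfl
    _ ≤ _ := by
      refine Finset.card_le_card_of_injOn (fun e i => (e i : Fin n)) ?_ ?_
      · intro e _
        have hav : ∀ i, (e i : Fin n) ≠ x ∧ (e i : Fin n) ≠ y := fun i =>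
          (Finset.mem_filter.mp (e i).2).2
        exact Finset.mem_coe.2 (Finset.mem_filter.2
          ⟨Finset.mem_univ _, Subtype.val_injective.comp e.injective, hav⟩)
      · intro e _ e' _ hee
        ext i
        have := congrFun hee i
        simpa using congrArg Fin.val this

end Counting

section Tiling

variable {h n : ℕ} {H : SimpleGraph (Fin h)} {G : SimpleGraph (Fin n)}

lemma HasPerfectTilingOn.union {S T : Finset (Fin n)} (hS : HasPerfectTilingOn H G S)
    (hT : HasPerfectTilingOn H G T) (hST : Disjoint S T) : HasPerfectTilingOn H G (S ∪ T) := by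
  obtain ⟨𝒮, h𝒮, hd, rfl⟩ := hS
  obtain ⟨𝒯, h𝒯, hd', rfl⟩ := hT
  refine ⟨𝒮 ∪ 𝒯, ?_, ?_, Finset.union_biUnion ..⟩
  · intro A hA
    rcases Finset.mem_union.1 hA with hA | hA
    exacts [h𝒮 A hA, h𝒯 A hA]
  · rw [Finset.coe_union, Set.pairwiseDisjoint_union]
    refine ⟨hd, hd', fun A hA B hB _ => ?_⟩
    exact hST.mono (Finset.subset_biUnion_of_mem id hA) (Finset.subset_biUnion_of_mem id hB)

lemma IsCopySet.hasPerfectTilingOn {S : Finset (Fin n)} (hS : IsCopySet H G S) :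
    HasPerfectTilingOn H G S :=
  ⟨{S}, by simpa using hS, by simp, by simp⟩

lemma hasPerfectTilingOn_empty : HasPerfectTilingOn H G ∅ :=
  ⟨∅, by simp, by simp, by simp⟩

/-- Three consecutive blocks of vertices are enumerated increasingly, block by block. -/
lemma exists_strictMono_of_blocks {A B C : Finset (Fin n)} {a b : ℕ}
    (hA : #A = a) (hB : #B = b) (habc : a + b + #C = h)
    (hAB : ∀ u ∈ A, ∀ v ∈ B, u < v) (hAC : ∀ u ∈ A, ∀ v ∈ C, u < v)
    (hBC : ∀ u ∈ B, ∀ v ∈ C, u < v) :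
    ∃ φ : Fin h → Fin n, StrictMono φ ∧ Finset.image φ univ = A ∪ B ∪ C ∧
      (∀ i : Fin h, (i : ℕ) < a → φ i ∈ A) ∧
      (∀ i : Fin h, a ≤ (i : ℕ) → (i : ℕ) < a + b → φ i ∈ B) ∧
      (∀ i : Fin h, a + b ≤ (i : ℕ) → φ i ∈ C) := by
  let φ : Fin h → Fin n := fun i =>
    if h₁ : (i : ℕ) < a then A.orderEmbOfFin hA ⟨i, h₁⟩
    else if h₂ : (i : ℕ) < a + b then B.orderEmbOfFin hB ⟨i - a, by omega⟩
    else C.orderEmbOfFin rfl ⟨i - (a + b), by omega⟩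
  have h1 : ∀ i : Fin h, (i : ℕ) < a → φ i ∈ A := fun i hi => by
    simp only [φ, dif_pos hi]
    exact Finset.orderEmbOfFin_mem ..
  have h2 : ∀ i : Fin h, a ≤ (i : ℕ) → (i : ℕ) < a + b → φ i ∈ B := fun i hi hi' => by
    simp only [φ, dif_neg hi.not_gt, dif_pos hi']
    exact Finset.orderEmbOfFin_mem ..
  have h3 : ∀ i : Fin h, a + b ≤ (i : ℕ) → φ i ∈ C := fun i hi => by
    simp only [φ, dif_neg hi.not_gt, dif_neg (show ¬ (i : ℕ) < a by omega)]
    exact Finset.orderEmbOfFin_mem ..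
  have hφ : StrictMono φ := by
    intro i j hij
    have hij' : (i : ℕ) < j := hij
    rcases lt_or_ge (j : ℕ) a with hj | hj
    · have hi : (i : ℕ) < a := by omega
      simp only [φ, dif_pos hi, dif_pos hj]
      exact (A.orderEmbOfFin hA).strictMono hij'
    rcases lt_or_ge (i : ℕ) a with hi | hi
    · rcases lt_or_ge (j : ℕ) (a + b) with hj' | hj'
      · exact hAB _ (h1 i hi) _ (h2 j hj hj')
      · exact hAC _ (h1 i hi) _ (h3 j hj')
    rcases lt_or_ge (j : ℕ) (a + b) with hj' | hj'
    · have hi' : (i : ℕ) < a + b := by omega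
      simp only [φ, dif_neg hi.not_gt, dif_neg hj.not_gt, dif_pos hi', dif_pos hj']
      exact (B.orderEmbOfFin hB).strictMono (Fin.mk_lt_mk.2 (by omega))
    rcases lt_or_ge (i : ℕ) (a + b) with hi' | hi'
    · exact hBC _ (h2 i hi hi') _ (h3 j hj')
    · simp only [φ, dif_neg hi.not_gt, dif_neg hj.not_gt, dif_neg hi'.not_gt, dif_neg hj'.not_gt]
      exact (C.orderEmbOfFin rfl).strictMono (Fin.mk_lt_mk.2 (by omega))
  refine ⟨φ, hφ, Finset.eq_of_subset_of_card_le ?_ ?_, h1, h2, h3⟩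
  · intro v hv
    obtain ⟨i, -, rfl⟩ := Finset.mem_image.1 hv
    simp only [Finset.mem_union]
    rcases lt_or_ge (i : ℕ) a with hi | hi
    · exact Or.inl (Or.inl (h1 i hi))
    rcases lt_or_ge (i : ℕ) (a + b) with hi' | hi'
    · exact Or.inl (Or.inr (h2 i hi hi'))
    · exact Or.inr (h3 i hi')
  · rw [Finset.card_image_of_injective _ hφ.injective, Finset.card_univ, Fintype.card_fin]
    have := Finset.card_union_le (A ∪ B) C
    have := Finset.card_union_le A B
    omega

/-- The edges of `H` run between `[2, s - 1]` and `[m + 1, h - 1]`, or between `[s, m - 1]`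
and `h`. -/
structure HasTailShape (H : SimpleGraph (Fin h)) (m s : ℕ) : Prop where
  two_le : 2 ≤ s
  lt_mid : s < m
  mid_lt : m < h
  edges : ∀ i j : Fin h, H.Adj i j → i < j → 1 ≤ (i : ℕ) ∧ (i : ℕ) + 1 < m ∧ m ≤ (j : ℕ) ∧
    (((i : ℕ) + 1 < s ∧ (j : ℕ) + 1 < h) ∨ (s ≤ (i : ℕ) + 1 ∧ (j : ℕ) + 1 = h))

lemma isOrderedCopy_of_forall_lt {φ : Fin h → Fin n} (hφ : StrictMono φ)
    (hadj : ∀ i j, H.Adj i j → i < j → G.Adj (φ i) (φ j)) : IsOrderedCopy H G φ := by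
  refine ⟨hφ, fun i j hij => ?_⟩
  rcases lt_trichotomy i j with hlt | rfl | hlt
  · exact hadj i j hij hlt
  · exact absurd hij (H.irrefl)
  · exact (hadj j i hij.symm hlt).symm

variable {m s : ℕ} {P Q Z : Finset (Fin n)}

/-- `P` lies to the left of `Q` and is completely joined to it. -/
def IsForwardComplete (G : SimpleGraph (Fin n)) (P Q : Finset (Fin n)) : Prop :=
  ∀ u ∈ P, ∀ v ∈ Q, u < v ∧ G.Adj u v

lemma IsForwardComplete.mono {P' Q' : Finset (Fin n)} (hPQ : IsForwardComplete G P Q)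
    (hP : P' ⊆ P) (hQ : Q' ⊆ Q) : IsForwardComplete G P' Q' :=
  fun u hu v hv => hPQ u (hP hu) v (hQ hv)

lemma IsForwardComplete.disjoint (hPQ : IsForwardComplete G P Q) : Disjoint P Q :=
  Finset.disjoint_left.2 fun u hu hv => lt_irrefl u (hPQ u hu u hv).1

lemma HasTailShape.isCopySet_first (hH : HasTailShape H m s) (hPQ : IsForwardComplete G P Q)
    (hZ : #Z ≤ 1) (hZP : ∀ z ∈ Z, ∀ v ∈ P, z < v) (hZQ : ∀ z ∈ Z, ∀ v ∈ Q, z < v)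
    (hm : m ≤ #Z + #P + 1) (hm' : #Z + #P ≤ m) (hcard : #Z + #P + #Q = h) :
    IsCopySet H G (Z ∪ P ∪ Q) := by
  obtain ⟨φ, hφ, him, -, h2, h3⟩ := exists_strictMono_of_blocks rfl rfl hcard hZP hZQ
    (fun u hu v hv => (hPQ u hu v hv).1)
  refine ⟨φ, isOrderedCopy_of_forall_lt hφ fun i j hij hlt => ?_, him⟩
  obtain ⟨e1, e2, e3, -⟩ := hH.edges i j hij hlt
  exact (hPQ _ (h2 i (by omega) (by omega)) _ (h3 j (by omega))).2

lemma HasTailShape.isCopySet_middle (hH : HasTailShape H m s) (hPQ : IsForwardComplete G P Q)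
    {x : Fin n} (hPx : ∀ v ∈ P, v < x) (hxQ : ∀ v ∈ Q, x < v)
    (hP : #P + 1 = m) (hQ : #Q + m = h) : IsCopySet H G (insert x (P ∪ Q)) := by
  obtain ⟨φ, hφ, him, h1, -, h3⟩ := exists_strictMono_of_blocks (A := P) (B := {x}) (C := Q)
    (h := h) rfl rfl (by simp; omega) (by simpa using hPx)
    (fun u hu v hv => (hPQ u hu v hv).1) (by simpa using hxQ)
  refine ⟨φ, isOrderedCopy_of_forall_lt hφ fun i j hij hlt => ?_, ?_⟩
  · obtain ⟨e1, e2, e3, -⟩ := hH.edges i j hij hlt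
    exact (hPQ _ (h1 i (by omega)) _ (h3 j (by simp; omega))).2
  · rw [him]; ext v; simp only [Finset.mem_union, Finset.mem_insert, Finset.mem_singleton]; tauto

lemma HasTailShape.isCopySet_last_of_left (hH : HasTailShape H m s)
    (hPQ : IsForwardComplete G P Q) {x : Fin n} (hPx : ∀ v ∈ P, v < x) (hQx : ∀ v ∈ Q, v < x)
    (hadj : ∀ v ∈ P, G.Adj v x) (hP : #P + 1 = m) (hQ : #Q + m = h) :
    IsCopySet H G (insert x (P ∪ Q)) := by
  obtain ⟨φ, hφ, him, h1, h2, h3⟩ := exists_strictMono_of_blocks (A := P) (B := Q) (C := {x})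
    (h := h) rfl rfl (by simp; omega) (fun u hu v hv => (hPQ u hu v hv).1)
    (by simpa using hPx) (by simpa using hQx)
  refine ⟨φ, isOrderedCopy_of_forall_lt hφ fun i j hij hlt => ?_, ?_⟩
  · obtain ⟨e1, e2, e3, e4⟩ := hH.edges i j hij hlt
    have hi := h1 i (by omega)
    rcases e4 with ⟨-, e5⟩ | ⟨-, e5⟩
    · exact (hPQ _ hi _ (h2 j (by omega) (by omega))).2
    · rw [Finset.mem_singleton.1 (h3 j (by omega))]
      exact hadj _ hi
  · rw [him]; ext v; simp only [Finset.mem_union, Finset.mem_insert, Finset.mem_singleton]; tauto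

lemma HasTailShape.isCopySet_last_of_right (hH : HasTailShape H m s)
    (hPQ : IsForwardComplete G P Q) {x : Fin n} (hPx : ∀ v ∈ P, v < x) (hQx : ∀ v ∈ Q, v < x)
    (hadj : ∀ v ∈ Q, G.Adj v x) (hP : #P + 1 = s) (hQ : #Q + s = h) :
    IsCopySet H G (insert x (P ∪ Q)) := by
  have hsm := hH.lt_mid
  obtain ⟨φ, hφ, him, h1, h2, h3⟩ := exists_strictMono_of_blocks (A := P) (B := Q) (C := {x})
    (h := h) rfl rfl (by simp; omega) (fun u hu v hv => (hPQ u hu v hv).1)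
    (by simpa using hPx) (by simpa using hQx)
  refine ⟨φ, isOrderedCopy_of_forall_lt hφ fun i j hij hlt => ?_, ?_⟩
  · obtain ⟨e1, e2, e3, ⟨e4, e5⟩ | ⟨e4, e5⟩⟩ := hH.edges i j hij hlt
    · exact (hPQ _ (h1 i (by omega)) _ (h2 j (by omega) (by omega))).2
    · rw [Finset.mem_singleton.1 (h3 j (by omega))]
      exact hadj _ (h2 i (by omega) (by omega))
  · rw [him]; ext v; simp only [Finset.mem_union, Finset.mem_insert, Finset.mem_singleton]; tauto

/-- `k` copies tile `Z ∪ P ∪ Q`, where `j` of them use `m - 1` vertices of `Z ∪ P` and the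
others use `m`. -/
lemma HasTailShape.hasPerfectTilingOn (hH : HasTailShape H m s) (k : ℕ) :
    ∀ (j : ℕ) (Z P Q : Finset (Fin n)), IsForwardComplete G P Q → #Z ≤ 1 →
      (∀ z ∈ Z, ∀ v ∈ P, z < v) → (∀ z ∈ Z, ∀ v ∈ Q, z < v) → j ≤ k →
      #Z + #P + j = k * m → #Q + k * m = k * h + j → HasPerfectTilingOn H G (Z ∪ P ∪ Q) := by
  have hs := hH.two_le
  have hsm := hH.lt_mid
  have hmh := hH.mid_lt
  induction k with
  | zero =>
    intro j Z P Q _ _ _ _ hj hZP hQ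
    have : #Z = 0 := by omega
    have : #P = 0 := by omega
    have : #Q = 0 := by omega
    simp_all only [Finset.card_eq_zero]
    exact hasPerfectTilingOn_empty
  | succ k ih =>
    intro j Z P Q hPQ hZ hZP hZQ hj hcP hcQ
    have hkm : k ≤ k * m := Nat.le_mul_of_pos_right k (by omega)
    have hkh : k * m ≤ k * h := Nat.mul_le_mul_left k hmh.le
    rw [add_one_mul] at hcP
    rw [add_one_mul, add_one_mul] at hcQ
    obtain ⟨ε, hε, hεj, hjε⟩ : ∃ ε, ε ≤ 1 ∧ ε ≤ j ∧ j - ε ≤ k := ⟨min 1 j, by omega⟩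
    obtain ⟨P', hP', hcP'⟩ := Finset.exists_subset_card_eq (s := P) (n := m - ε - #Z) (by omega)
    obtain ⟨Q', hQ', hcQ'⟩ := Finset.exists_subset_card_eq (s := Q) (n := h - m + ε) (by omega)
    have hfirst : IsCopySet H G (Z ∪ P' ∪ Q') :=
      hH.isCopySet_first (hPQ.mono hP' hQ') hZ (fun z hz v hv => hZP z hz v (hP' hv))
        (fun z hz v hv => hZQ z hz v (hQ' hv)) (by omega) (by omega) (by omega)
    have hrest : HasPerfectTilingOn H G (∅ ∪ P \ P' ∪ Q \ Q') := by
      have := Finset.card_sdiff_of_subset hP'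
      have := Finset.card_sdiff_of_subset hQ'
      refine ih (j - ε) ∅ _ _ (hPQ.mono Finset.sdiff_subset Finset.sdiff_subset) (by simp)
        (by simp) (by simp) hjε ?_ ?_
      · simp only [Finset.card_empty]; omega
      · omega
    have hZP' : Disjoint Z P := Finset.disjoint_left.2 fun u hu hv => lt_irrefl u (hZP u hu u hv)
    have hZQ' : Disjoint Z Q := Finset.disjoint_left.2 fun u hu hv => lt_irrefl u (hZQ u hu u hv)
    have hd := hPQ.disjoint
    convert hfirst.hasPerfectTilingOn.union hrest ?_ using 1
    · ext v
      have := @hP' v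
      have := @hQ' v
      simp only [Finset.mem_union, Finset.mem_sdiff, Finset.notMem_empty]
      tauto
    · rw [Finset.disjoint_left] at *
      intro v
      have := @hP' v
      have := @hQ' v
      have := @hZP' v
      have := @hZQ' v
      have := @hd v
      simp only [Finset.mem_union, Finset.mem_sdiff, Finset.notMem_empty]
      tauto

/-- Split off one copy through `x`, and tile the rest. -/
lemma HasTailShape.hasPerfectTilingOn_insert (hH : HasTailShape H m s) {k : ℕ} {x : Fin n}
    {P Q : Finset (Fin n)} (hPQ : IsForwardComplete G P Q) (hxP : x ∉ P) (hxQ : x ∉ Q)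
    (a b : ℕ) (ha : #P = a + k * m) (hb : #Q + k * m = b + k * h)
    (hcopy : ∀ P' ⊆ P, ∀ Q' ⊆ Q, #P' = a → #Q' = b → IsCopySet H G (insert x (P' ∪ Q'))) :
    HasPerfectTilingOn H G (insert x (P ∪ Q)) := by
  have hkh : k * m ≤ k * h := Nat.mul_le_mul_left k hH.mid_lt.le
  obtain ⟨P', hP', hcP'⟩ := Finset.exists_subset_card_eq (s := P) (n := a) (by omega)
  obtain ⟨Q', hQ', hcQ'⟩ := Finset.exists_subset_card_eq (s := Q) (n := b) (by omega)
  have hrest : HasPerfectTilingOn H G (∅ ∪ P \ P' ∪ Q \ Q') := by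
    have := Finset.card_sdiff_of_subset hP'
    have := Finset.card_sdiff_of_subset hQ'
    refine hH.hasPerfectTilingOn k 0 ∅ _ _ (hPQ.mono Finset.sdiff_subset Finset.sdiff_subset)
      (by simp) (by simp) (by simp) (Nat.zero_le _) ?_ ?_
    · simp only [Finset.card_empty]; omega
    · omega
  have hd := hPQ.disjoint
  convert (hcopy P' hP' Q' hQ' hcP' hcQ').hasPerfectTilingOn.union hrest ?_ using 1
  · ext v
    have := @hP' v
    have := @hQ' v
    simp only [Finset.mem_union, Finset.mem_sdiff, Finset.notMem_empty, Finset.mem_insert]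
    tauto
  · rw [Finset.disjoint_left] at *
    intro v
    have := @hP' v
    have := @hQ' v
    have := @hd v
    simp only [Finset.mem_union, Finset.mem_sdiff, Finset.notMem_empty, Finset.mem_insert]
    rintro (rfl | hv) <;> tauto

end Tiling

section Gadget

variable {h n m s : ℕ} {H : SimpleGraph (Fin h)} {G : SimpleGraph (Fin n)}

/-- A relation `R` and sizes `p`, `q` such that every biclique of `R` with parts of sizes `p`
and `q` can be tiled after adding `x`, and also after adding any of the first `k` vertices. -/
def IsGadget (H : SimpleGraph (Fin h)) (G : SimpleGraph (Fin n)) (k : ℕ) (x : Fin n)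
    (R : Finset (Fin n × Fin n)) (p q : ℕ) : Prop :=
  ∀ P Q : Finset (Fin n), #P = p → #Q = q → P ×ˢ Q ⊆ R →
    HasPerfectTilingOn H G (insert x (P ∪ Q)) ∧
    ∀ z : Fin n, (z : ℕ) < k → HasPerfectTilingOn H G (insert z (P ∪ Q))

lemma HasTailShape.isGadget (hH : HasTailShape H m s) {k : ℕ} {x : Fin n}
    {R : Finset (Fin n × Fin n)} {p q j t : ℕ} (ht : 1 ≤ t) (hj : j ≤ t)
    (hp : p + 1 + j = t * m) (hq : q + t * m = t * h + j)
    (hR : ∀ v w, (v, w) ∈ R → v < w ∧ G.Adj v w ∧ k ≤ (v : ℕ))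
    (hx : ∀ P Q : Finset (Fin n), #P = p → #Q = q → P.Nonempty → Q.Nonempty →
      (∀ v ∈ P, ∀ w ∈ Q, (v, w) ∈ R) → IsForwardComplete G P Q →
      HasPerfectTilingOn H G (insert x (P ∪ Q))) : IsGadget H G k x R p q := by
  intro P Q hP hQ hPQR
  have hs := hH.two_le
  have hsm := hH.lt_mid
  have hmh := hH.mid_lt
  have hmem : ∀ v ∈ P, ∀ w ∈ Q, (v, w) ∈ R := fun v hv w hw =>
    hPQR (Finset.mk_mem_product hv hw)
  have hPQ : IsForwardComplete G P Q := fun v hv w hw =>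
    ⟨(hR v w (hmem v hv w hw)).1, (hR v w (hmem v hv w hw)).2.1⟩
  have h3 : t * 3 ≤ t * m := Nat.mul_le_mul_left t (by omega)
  have h4 : t * (m + 1) ≤ t * h := Nat.mul_le_mul_left t (by omega)
  rw [mul_add_one] at h4
  obtain ⟨v₀, hv₀⟩ : P.Nonempty := Finset.card_pos.1 (by omega)
  obtain ⟨w₀, hw₀⟩ : Q.Nonempty := Finset.card_pos.1 (by omega)
  refine ⟨hx P Q hP hQ ⟨v₀, hv₀⟩ ⟨w₀, hw₀⟩ hmem hPQ, fun z hz => ?_⟩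
  have hzP : ∀ v ∈ P, z < v := fun v hv =>
    Fin.lt_def.2 (hz.trans_le (hR v w₀ (hmem v hv w₀ hw₀)).2.2)
  have hzQ : ∀ w ∈ Q, z < w := fun w hw => (hzP v₀ hv₀).trans (hPQ v₀ hv₀ w hw).1
  have := hH.hasPerfectTilingOn t j {z} P Q hPQ (by simp) (by simpa using hzP)
    (by simpa using hzQ) hj (by rw [Finset.card_singleton]; omega) (by omega)
  rwa [Finset.union_assoc, ← Finset.insert_eq] at this

variable {k : ℕ} {x : Fin n} {R : Finset (Fin n × Fin n)} {p q t : ℕ}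

lemma HasTailShape.isGadget_of_first (hH : HasTailShape H m s) (ht : 1 ≤ t)
    (hp : p + 1 = t * m) (hq : q + t * m = t * h)
    (hR : ∀ v w, (v, w) ∈ R → v < w ∧ G.Adj v w ∧ k ≤ (v : ℕ))
    (hx : ∀ v w, (v, w) ∈ R → x < v) : IsGadget H G k x R p q := by
  refine hH.isGadget ht (Nat.zero_le _) hp hq hR fun P Q hP hQ ⟨v₀, hv₀⟩ ⟨w₀, hw₀⟩ hmem hPQ => ?_
  have hxP : ∀ v ∈ P, x < v := fun v hv => hx v w₀ (hmem v hv w₀ hw₀)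
  have hxQ : ∀ w ∈ Q, x < w := fun w hw => (hxP v₀ hv₀).trans (hPQ v₀ hv₀ w hw).1
  have := hH.hasPerfectTilingOn t 0 {x} P Q hPQ (by simp) (by simpa using hxP)
    (by simpa using hxQ) (Nat.zero_le _) (by rw [Finset.card_singleton]; omega) (by omega)
  rwa [Finset.union_assoc, ← Finset.insert_eq] at this

lemma HasTailShape.isGadget_of_middle (hH : HasTailShape H m s) (ht : 1 ≤ t)
    (hp : p + 1 = t * m) (hq : q + t * m = t * h)
    (hR : ∀ v w, (v, w) ∈ R → v < w ∧ G.Adj v w ∧ k ≤ (v : ℕ))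
    (hx : ∀ v w, (v, w) ∈ R → v < x ∧ x < w) : IsGadget H G k x R p q := by
  have hsm := hH.lt_mid
  have hmh := hH.mid_lt
  refine hH.isGadget ht (Nat.zero_le _) hp hq hR fun P Q hP hQ ⟨v₀, hv₀⟩ ⟨w₀, hw₀⟩ hmem hPQ => ?_
  have hPx : ∀ v ∈ P, v < x := fun v hv => (hx v w₀ (hmem v hv w₀ hw₀)).1
  have hxQ : ∀ w ∈ Q, x < w := fun w hw => (hx v₀ w (hmem v₀ hv₀ w hw)).2
  obtain ⟨t, rfl⟩ := Nat.exists_eq_add_of_le' ht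
  rw [add_one_mul] at hp
  rw [add_one_mul, add_one_mul] at hq
  refine hH.hasPerfectTilingOn_insert (k := t) hPQ (fun hv => (hPx x hv).false)
    (fun hv => (hxQ x hv).false) (m - 1) (h - m) (by omega) (by omega)
    fun P' hP' Q' hQ' hcP hcQ => ?_
  exact hH.isCopySet_middle (hPQ.mono hP' hQ') (fun v hv => hPx v (hP' hv))
    (fun v hv => hxQ v (hQ' hv)) (by omega) (by omega)

lemma HasTailShape.isGadget_of_last_left (hH : HasTailShape H m s) (ht : 1 ≤ t)
    (hp : p + 1 = t * m) (hq : q + t * m = t * h)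
    (hR : ∀ v w, (v, w) ∈ R → v < w ∧ G.Adj v w ∧ k ≤ (v : ℕ))
    (hx : ∀ v w, (v, w) ∈ R → w < x ∧ G.Adj x v) : IsGadget H G k x R p q := by
  have hsm := hH.lt_mid
  have hmh := hH.mid_lt
  refine hH.isGadget ht (Nat.zero_le _) hp hq hR fun P Q hP hQ ⟨v₀, hv₀⟩ ⟨w₀, hw₀⟩ hmem hPQ => ?_
  have hQx : ∀ w ∈ Q, w < x := fun w hw => (hx v₀ w (hmem v₀ hv₀ w hw)).1
  have hPx : ∀ v ∈ P, v < x := fun v hv => (hPQ v hv w₀ hw₀).1.trans (hQx w₀ hw₀)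
  obtain ⟨t, rfl⟩ := Nat.exists_eq_add_of_le' ht
  rw [add_one_mul] at hp
  rw [add_one_mul, add_one_mul] at hq
  refine hH.hasPerfectTilingOn_insert (k := t) hPQ (fun hv => (hPx x hv).false)
    (fun hv => (hQx x hv).false) (m - 1) (h - m) (by omega) (by omega)
    fun P' hP' Q' hQ' hcP hcQ => ?_
  exact hH.isCopySet_last_of_left (hPQ.mono hP' hQ') (fun v hv => hPx v (hP' hv))
    (fun v hv => hQx v (hQ' hv))
    (fun v hv => (hx v w₀ (hmem v (hP' hv) w₀ hw₀)).2.symm) (by omega) (by omega)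

lemma HasTailShape.isGadget_of_last_right (hH : HasTailShape H m s) (ht : t + s = m)
    (hp : p + 1 + t = t * m) (hq : q + t * m = t * h + t)
    (hR : ∀ v w, (v, w) ∈ R → v < w ∧ G.Adj v w ∧ k ≤ (v : ℕ))
    (hx : ∀ v w, (v, w) ∈ R → w < x ∧ G.Adj x w) : IsGadget H G k x R p q := by
  have hs := hH.two_le
  have hsm := hH.lt_mid
  have hmh := hH.mid_lt
  refine hH.isGadget (by omega) le_rfl hp hq hR
    fun P Q hP hQ ⟨v₀, hv₀⟩ ⟨w₀, hw₀⟩ hmem hPQ => ?_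
  have hQx : ∀ w ∈ Q, w < x := fun w hw => (hx v₀ w (hmem v₀ hv₀ w hw)).1
  have hPx : ∀ v ∈ P, v < x := fun v hv => (hPQ v hv w₀ hw₀).1.trans (hQx w₀ hw₀)
  obtain ⟨t, rfl⟩ := Nat.exists_eq_add_of_le' (show 1 ≤ t by omega)
  rw [add_one_mul] at hp
  rw [add_one_mul, add_one_mul] at hq
  refine hH.hasPerfectTilingOn_insert (k := t) hPQ (fun hv => (hPx x hv).false)
    (fun hv => (hQx x hv).false) (s - 1) (h - s) (by omega) (by omega)
    fun P' hP' Q' hQ' hcP hcQ => ?_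
  exact hH.isCopySet_last_of_right (hPQ.mono hP' hQ') (fun v hv => hPx v (hP' hv))
    (fun v hv => hQx v (hQ' hv))
    (fun w hw => (hx v₀ w (hmem v₀ hv₀ w (hQ' hw))).2.symm) (by omega) (by omega)

/-- All but at most `2 * k` neighbours lie outside the first and the last `k` vertices. -/
lemma le_card_adj_middle [DecidableRel G.Adj] (hdeg : ∀ v, 4 * k ≤ odeg G v) (v : Fin n) :
    2 * k ≤ #{w ∈ ({w : Fin n | k ≤ (w : ℕ) ∧ (w : ℕ) < n - k} : Finset (Fin n)) |
      G.Adj v w} := by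
  have h1 : odeg G v = #{w : Fin n | G.Adj v w} := by
    rw [odeg, ← Set.ncard_coe_finset]
    congr 1
    ext w
    simp
  set A : Finset (Fin n) := {w | (w : ℕ) < k} with hA
  set B : Finset (Fin n) := {w | n - k ≤ (w : ℕ)} with hB
  set M : Finset (Fin n) :=
    {w ∈ ({w : Fin n | k ≤ (w : ℕ) ∧ (w : ℕ) < n - k} : Finset (Fin n)) | G.Adj v w} with hM
  have h2 : #A ≤ #(Finset.range k) :=
    Finset.card_le_card_of_injOn (fun w => (w : ℕ)) (fun w hw => by simpa [hA] using hw)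
      (fun a _ b _ hab => Fin.ext hab)
  have h3 : #B ≤ #(Finset.Ico (n - k) n) :=
    Finset.card_le_card_of_injOn (fun w => (w : ℕ)) (fun w hw => by simpa [hB] using hw)
      (fun a _ b _ hab => Fin.ext hab)
  have h4 : ({w : Fin n | G.Adj v w} : Finset (Fin n)) ⊆ M ∪ (A ∪ B) := by
    intro w hw
    simp only [Finset.mem_filter, Finset.mem_univ, true_and] at hw
    simp only [hA, hB, hM, Finset.mem_union, Finset.mem_filter, Finset.mem_univ, true_and, hw,
      and_true]
    omega
  have h5 := Finset.card_le_card h4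
  have h6 := hdeg v
  have h7 := Finset.card_union_le M (A ∪ B)
  have h8 := Finset.card_union_le A B
  rw [Finset.card_range] at h2
  rw [Nat.card_Ico] at h3
  omega

lemma HasTailShape.exists_isGadget (hH : HasTailShape H m s) (hk : 1 ≤ k)
    (hdeg : ∀ v, 4 * k ≤ odeg G v) (x : Fin n) :
    ∃ p q, p + q + 1 = (m - s) * h ∧ ∃ R : Finset (Fin n × Fin n), k ^ 2 ≤ 2 * #R ∧
      IsGadget H G k x R p q := by
  classical
  have hs := hH.two_le
  have hsm := hH.lt_mid
  have hmh := hH.mid_lt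
  obtain ⟨t, ht⟩ : ∃ t, t + s = m := ⟨m - s, by omega⟩
  rw [show m - s = t by omega]
  have h3 : t * 3 ≤ t * m := Nat.mul_le_mul_left t (by omega)
  have h4 : t * m ≤ t * h := Nat.mul_le_mul_left t hmh.le
  have hkn : k ≤ n := by
    have h1 := hdeg x
    have h2 : odeg G x ≤ n := by
      have := Set.ncard_le_card (G.neighborSet x)
      simpa [odeg] using this
    omega
  set W : Finset (Fin n) := {w : Fin n | k ≤ (w : ℕ) ∧ (w : ℕ) < n - k} with hW
  have hmemW : ∀ w, w ∈ W ↔ k ≤ (w : ℕ) ∧ (w : ℕ) < n - k := fun w => by simp [hW]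
  have hWdeg : ∀ v, 2 * k ≤ #{w ∈ W | G.Adj v w} := le_card_adj_middle hdeg
  let sw : Fin n × Fin n ↪ Fin n × Fin n := (Equiv.prodComm _ _).toEmbedding
  have hsw : ∀ (E : Finset (Fin n × Fin n)) v w, (v, w) ∈ E.map sw ↔ (w, v) ∈ E := by
    intro E v w
    simp [sw]
  rcases lt_or_ge (x : ℕ) (n - k) with hx | hx
  · set L : Finset (Fin n) := {w : Fin n | n - k ≤ (w : ℕ)} with hL
    have hmemL : ∀ w, w ∈ L ↔ n - k ≤ (w : ℕ) := fun w => by simp [hL]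
    have hcL : k ≤ #L := by
      calc k = #(univ : Finset (Fin k)) := by simp
        _ ≤ #L := Finset.card_le_card_of_injOn (fun i => ⟨n - k + i, by omega⟩)
          (fun i _ => by simp [hL]; omega) (fun a _ b _ hab => by
            simp only [Fin.mk.injEq] at hab
            exact Fin.ext (by omega))
    have hE : k * k ≤ #{e ∈ L ×ˢ (W.erase x) | G.Adj e.1 e.2} := by
      refine (Nat.mul_le_mul_right k hcL).trans (card_mul_le_card_adj G L _ k fun w _ => ?_)
      have h1 := hWdeg w
      have h2 := Finset.pred_card_le_card_erase (s := {v ∈ W | G.Adj w v}) (a := x)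
      rw [← Finset.filter_erase] at h2
      omega
    set E := {e ∈ L ×ˢ (W.erase x) | G.Adj e.1 e.2} with hEdef
    have hmemE : ∀ v w, (w, v) ∈ E → v < w ∧ G.Adj v w ∧ k ≤ (v : ℕ) ∧ v ≠ x ∧ x < w := by
      intro v w he
      simp only [hEdef, Finset.mem_filter, Finset.mem_product, Finset.mem_erase, hmemL,
        hmemW] at he
      obtain ⟨⟨h1, h2, h3, h4⟩, h5⟩ := he
      exact ⟨Fin.lt_def.2 (by omega), h5.symm, h3, h2, Fin.lt_def.2 (by omega)⟩
    have hsplit := Finset.card_filter_add_card_filter_not (s := E) (fun e => x < e.2)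
    refine ⟨t * m - 1, t * h - t * m, by omega, ?_⟩
    rcases le_total #{e ∈ E | ¬ x < e.2} #{e ∈ E | x < e.2} with hle | hle
    · refine ⟨{e ∈ E | x < e.2}.map sw, by rw [Finset.card_map, sq]; omega,
        hH.isGadget_of_first (t := t) (by omega) (by omega) (by omega) ?_ ?_⟩
      · intro v w hvw
        have := hmemE v w (Finset.mem_filter.1 ((hsw _ _ _).1 hvw)).1
        exact ⟨this.1, this.2.1, this.2.2.1⟩
      · intro v w hvw
        exact (Finset.mem_filter.1 ((hsw _ _ _).1 hvw)).2
    · refine ⟨{e ∈ E | ¬ x < e.2}.map sw, by rw [Finset.card_map, sq]; omega,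
        hH.isGadget_of_middle (t := t) (by omega) (by omega) (by omega) ?_ ?_⟩
      · intro v w hvw
        have := hmemE v w (Finset.mem_filter.1 ((hsw _ _ _).1 hvw)).1
        exact ⟨this.1, this.2.1, this.2.2.1⟩
      · intro v w hvw
        have h1 := Finset.mem_filter.1 ((hsw _ _ _).1 hvw)
        have h2 := hmemE v w h1.1
        exact ⟨lt_of_le_of_ne (not_lt.1 h1.2) h2.2.2.2.1, h2.2.2.2.2⟩
  · set N : Finset (Fin n) := {w ∈ W | G.Adj x w} with hN
    have hE : 2 * k * (2 * k) ≤ #{e ∈ N ×ˢ W | G.Adj e.1 e.2} :=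
      (Nat.mul_le_mul_right _ (hWdeg x)).trans
        (card_mul_le_card_adj G N W (2 * k) fun w _ => hWdeg w)
    set E := {e ∈ N ×ˢ W | G.Adj e.1 e.2} with hEdef
    have hmemE : ∀ v w, (v, w) ∈ E →
        G.Adj x v ∧ G.Adj v w ∧ k ≤ (v : ℕ) ∧ k ≤ (w : ℕ) ∧ v < x ∧ w < x := by
      intro v w he
      simp only [hEdef, hN, Finset.mem_filter, Finset.mem_product, hmemW] at he
      obtain ⟨⟨⟨h1, h2⟩, h3⟩, h5⟩ := he
      exact ⟨h2, h5, h1.1, h3.1, Fin.lt_def.2 (by omega), Fin.lt_def.2 (by omega)⟩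
    have hsplit := Finset.card_filter_add_card_filter_not (s := E) (fun e => e.1 < e.2)
    have hEk : k * k ≤ #E := le_trans (by nlinarith) hE
    rcases le_total #{e ∈ E | ¬ e.1 < e.2} #{e ∈ E | e.1 < e.2} with hle | hle
    · refine ⟨t * m - 1, t * h - t * m, by omega, {e ∈ E | e.1 < e.2}, by rw [sq]; omega,
        hH.isGadget_of_last_left (t := t) (by omega) (by omega) (by omega) ?_ ?_⟩
      · intro v w hvw
        have h1 := Finset.mem_filter.1 hvw
        have h2 := hmemE v w h1.1
        exact ⟨h1.2, h2.2.1, h2.2.2.1⟩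
      · intro v w hvw
        have h2 := hmemE v w (Finset.mem_filter.1 hvw).1
        exact ⟨h2.2.2.2.2.2, h2.1⟩
    · refine ⟨t * m - 1 - t, t * h - t * m + t, by omega, {e ∈ E | ¬ e.1 < e.2}.map sw,
        by rw [Finset.card_map, sq]; omega,
        hH.isGadget_of_last_right ht (by omega) (by omega) ?_ ?_⟩
      · intro v w hvw
        have h1 := Finset.mem_filter.1 ((hsw _ _ _).1 hvw)
        have h2 := hmemE w v h1.1
        exact ⟨lt_of_le_of_ne (not_lt.1 h1.2) h2.2.1.ne', h2.2.1.symm, h2.2.2.2.1⟩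
      · intro v w hvw
        have h2 := hmemE w v (Finset.mem_filter.1 ((hsw _ _ _).1 hvw)).1
        exact ⟨h2.2.2.2.2.1, h2.1⟩

end Gadget

section Connecting

variable {h n : ℕ} {H : SimpleGraph (Fin h)} {G : SimpleGraph (Fin n)}

/-- The vertices of `f`, if distinct, can be tiled after adding `x`, and also after adding any
of the first `k` vertices. -/
def IsConnector (H : SimpleGraph (Fin h)) (G : SimpleGraph (Fin n)) (k : ℕ) (x : Fin n) {N : ℕ}
    (f : Fin N → Fin n) : Prop :=
  Function.Injective f → HasPerfectTilingOn H G (insert x (Finset.image f univ)) ∧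
    ∀ z : Fin n, (z : ℕ) < k → HasPerfectTilingOn H G (insert z (Finset.image f univ))

open Classical in
lemma IsGadget.card_pow_mul_le {k p q : ℕ} {x : Fin n} {R : Finset (Fin n × Fin n)}
    (hR : IsGadget H G k x R p q) :
    #R ^ (p * q) * n ^ (p + q) ≤
      #{f : Fin (p + q) → Fin n | IsConnector H G k x f} * n ^ (2 * (p * q)) := by
  have h1 := card_pow_mul_le_card_biclique R p q
  rw [Fintype.card_fin] at h1
  refine h1.trans (Nat.mul_le_mul_right _ ?_)
  refine Finset.card_le_card_of_injOn (fun F => Fin.append F.1 F.2) ?_ ?_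
  · rintro ⟨f, g⟩ hfg
    simp only [coe_filter, mem_univ, true_and, Set.mem_ofPred_eq] at hfg ⊢
    intro hinj
    have him : Finset.image (Fin.append f g) univ =
        Finset.image f univ ∪ Finset.image g univ := by
      ext v
      simp only [Finset.mem_union, Finset.mem_image, Finset.mem_univ, true_and]
      constructor
      · rintro ⟨i, rfl⟩
        refine Fin.addCases (fun i => ?_) (fun i => ?_) i <;> simp
      · rintro (⟨i, rfl⟩ | ⟨i, rfl⟩)
        exacts [⟨Fin.castAdd q i, by simp⟩, ⟨Fin.natAdd p i, by simp⟩]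
    have hf : Function.Injective f := fun a b hab => by
      have := @hinj (Fin.castAdd q a) (Fin.castAdd q b) (by simpa using hab)
      simpa using this
    have hg : Function.Injective g := fun a b hab => by
      have := @hinj (Fin.natAdd p a) (Fin.natAdd p b) (by simpa using hab)
      simpa using this
    rw [him]
    refine hR _ _ (by simp [Finset.card_image_of_injective _ hf])
      (by simp [Finset.card_image_of_injective _ hg]) ?_
    rintro ⟨v, w⟩ hvw
    simp only [Finset.mem_product, Finset.mem_image, Finset.mem_univ, true_and] at hvw
    obtain ⟨⟨i, rfl⟩, ⟨j, rfl⟩⟩ := hvw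
    exact hfg i j
  · rintro ⟨f, g⟩ _ ⟨f', g'⟩ _ hfg
    simp only at hfg
    refine Prod.ext (funext fun i => ?_) (funext fun i => ?_)
    · simpa using congrFun hfg (Fin.castAdd q i)
    · simpa using congrFun hfg (Fin.natAdd p i)

open Classical in
lemma HasTailShape.le_card_isConnector {m s : ℕ} (hH : HasTailShape H m s) {N k : ℕ}
    (hN : N + 1 = (m - s) * h) (hk : 1 ≤ k) (hdeg : ∀ v, 4 * k ≤ odeg G v) {c : ℝ} (hc : 0 ≤ c)
    (hc1 : c ≤ 1) (hck : 2 * (c * (n : ℝ) ^ 2) ≤ (k : ℝ) ^ 2) (x : Fin n) :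
    c ^ (N * N) * (n : ℝ) ^ N ≤ #{f : Fin N → Fin n | IsConnector H G k x f} := by
  obtain ⟨p, q, hpq, R, hkR, hR⟩ := hH.exists_isGadget hk hdeg x
  obtain rfl : p + q = N := by omega
  have hn : (0 : ℝ) < n := by exact_mod_cast x.pos
  have h1 : ((#R : ℕ) : ℝ) ^ (p * q) * (n : ℝ) ^ (p + q) ≤
      #{f : Fin (p + q) → Fin n | IsConnector H G k x f} * (n : ℝ) ^ (2 * (p * q)) := by
    exact_mod_cast hR.card_pow_mul_le
  have h2 : (k : ℝ) ^ 2 ≤ 2 * #R := by exact_mod_cast hkR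
  have h3 : c * (n : ℝ) ^ 2 ≤ #R := by linarith
  have h4 : c ^ ((p + q) * (p + q)) ≤ c ^ (p * q) :=
    pow_le_pow_of_le_one hc hc1 (Nat.mul_le_mul (Nat.le_add_right _ _) (Nat.le_add_left _ _))
  refine le_of_mul_le_mul_right ?_ (pow_pos hn (2 * (p * q)))
  calc c ^ ((p + q) * (p + q)) * (n : ℝ) ^ (p + q) * (n : ℝ) ^ (2 * (p * q))
      ≤ c ^ (p * q) * (n : ℝ) ^ (p + q) * (n : ℝ) ^ (2 * (p * q)) := by gcongr
    _ = (c * (n : ℝ) ^ 2) ^ (p * q) * (n : ℝ) ^ (p + q) := by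
      rw [mul_pow, ← pow_mul]; ring
    _ ≤ (#R : ℝ) ^ (p * q) * (n : ℝ) ^ (p + q) := by gcongr
    _ ≤ _ := h1

/-- Two connectors sharing a vertex `z` combine into a set connecting `x` and `y`. -/
lemma hasPerfectTilingOn_of_isConnector {N k : ℕ} {x y : Fin n}
    {F : Fin N ⊕ Fin N ⊕ Unit → Fin n} (hF : Function.Injective F)
    (hFxy : ∀ i, F i ≠ x ∧ F i ≠ y) (hx : IsConnector H G k x fun i => F (.inl i))
    (hy : IsConnector H G k y fun i => F (.inr (.inl i))) (hz : (F (.inr (.inr ())) : ℕ) < k) :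
    HasPerfectTilingOn H G (insert x (Finset.image F univ)) ∧
      HasPerfectTilingOn H G (insert y (Finset.image F univ)) := by
  obtain ⟨hx1, hx2⟩ := hx (hF.comp Sum.inl_injective)
  obtain ⟨hy1, hy2⟩ := hy (hF.comp (Sum.inr_injective.comp Sum.inl_injective))
  constructor
  · convert hx1.union (hy2 _ hz) ?_ using 1
    · ext v
      simp only [Finset.mem_insert, Finset.mem_image, Finset.mem_univ, true_and, Sum.exists,
        Finset.mem_union, Unique.exists_iff, PUnit.default_eq_unit]
      simp only [@eq_comm _ v]
      tauto
    · rw [Finset.disjoint_left]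
      intro v
      simp only [Finset.mem_insert, Finset.mem_image, Finset.mem_univ, true_and]
      rintro (rfl | ⟨i, rfl⟩) (hv | ⟨j, hv⟩)
      · exact (hFxy _).1 hv.symm
      · exact (hFxy _).1 hv
      · exact absurd (hF hv) (by simp)
      · exact absurd (hF hv) (by simp)
  · convert (hx2 _ hz).union hy1 ?_ using 1
    · ext v
      simp only [Finset.mem_insert, Finset.mem_image, Finset.mem_univ, true_and, Sum.exists,
        Finset.mem_union, Unique.exists_iff, PUnit.default_eq_unit]
      simp only [@eq_comm _ v]
      tauto
    · rw [Finset.disjoint_right]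
      intro v
      simp only [Finset.mem_insert, Finset.mem_image, Finset.mem_univ, true_and]
      rintro (rfl | ⟨i, rfl⟩) (hv | ⟨j, hv⟩)
      · exact (hFxy _).2 hv.symm
      · exact (hFxy _).2 hv
      · exact absurd (hF hv) (by simp)
      · exact absurd (hF hv) (by simp)

/-- At most `K ^ K` functions on a `K`-element type have a given image. -/
lemma card_le_pow_mul_card_image_univ {ι α : Type*} [Fintype ι] [DecidableEq ι] [DecidableEq α]
    (S : Finset (ι → α)) :
    #S ≤ Fintype.card ι ^ Fintype.card ι * #(S.image fun F => Finset.image F univ) := by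
  refine Finset.card_le_mul_card_image S _ fun X hX => ?_
  have hXc : #X ≤ Fintype.card ι := by
    obtain ⟨F, -, rfl⟩ := Finset.mem_image.1 hX
    exact Finset.card_image_le
  calc _ ≤ #(Fintype.piFinset fun _ : ι => X) := Finset.card_le_card fun F hF => by
        rw [Fintype.mem_piFinset]
        intro i
        rw [← (Finset.mem_filter.1 hF).2]
        exact Finset.mem_image_of_mem F (Finset.mem_univ i)
    _ = #X ^ Fintype.card ι := by simp
    _ ≤ _ := Nat.pow_le_pow_left hXc _

/-- Almost all functions are injective and avoid two given vertices. -/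
lemma one_sub_mul_pow_le_card_injective_avoiding {ι : Type*} [Fintype ι] [DecidableEq ι] {δ : ℝ}
    (hn : (Fintype.card ι + 1 : ℝ) ≤ n)
    (hδ : Fintype.card ι * (Fintype.card ι + 1 : ℝ) ≤ δ * n) (x y : Fin n) :
    (1 - δ) * (n : ℝ) ^ Fintype.card ι ≤
      #{F : ι → Fin n | Function.Injective F ∧ ∀ i, F i ≠ x ∧ F i ≠ y} := by
  set K := Fintype.card ι with hK
  have hn0 : (0 : ℝ) < n := by exact_mod_cast x.pos
  have h1 : (((n - (K + 1)) ^ K : ℕ) : ℝ) ≤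
      #{F : ι → Fin n | Function.Injective F ∧ ∀ i, F i ≠ x ∧ F i ≠ y} := by
    exact_mod_cast pow_le_card_injective_avoiding (ι := ι) x y
  refine le_trans ?_ h1
  have h2 : K + 1 ≤ n := by exact_mod_cast hn
  rw [Nat.cast_pow, Nat.cast_sub h2]
  push_cast
  have h3 : ((n : ℝ) - (K + 1)) = (1 + -((K + 1 : ℝ) / n)) * n := by field_simp; ring
  rw [h3, mul_pow]
  have h4 : (K + 1 : ℝ) / n ≤ 1 := (div_le_one hn0).2 hn
  have h5 := one_add_mul_le_pow (a := -((K + 1 : ℝ) / n)) (by linarith) K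
  have h6 : K * ((K + 1 : ℝ) / n) ≤ δ := by
    rw [← mul_div_assoc, div_le_iff₀ hn0]; exact hδ
  refine mul_le_mul_of_nonneg_right (le_trans ?_ h5) (by positivity)
  linarith

open Classical in
/-- Counting the sets obtained by combining connectors for `x` and for `y`. -/
lemma le_ncard_of_le_card_isConnector {N k : ℕ} {γ β δ : ℝ} (hγ : 0 ≤ γ) (hβ : 0 ≤ β)
    (hδ : 2 * δ ≤ γ * γ * β)
    (hγc : ∀ x : Fin n, γ * (n : ℝ) ^ N ≤ #{f : Fin N → Fin n | IsConnector H G k x f})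
    (hk : β * n ≤ k) (hkn : k ≤ n) (hn : ((2 * N + 1 : ℕ) + 1 : ℝ) ≤ n)
    (hnδ : (2 * N + 1 : ℕ) * ((2 * N + 1 : ℕ) + 1 : ℝ) ≤ δ * n) (x y : Fin n) :
    δ / ((2 * N + 1 : ℕ) : ℝ) ^ (2 * N + 1) * (n : ℝ) ^ (2 * N + 1) ≤
      ({X : Finset (Fin n) | x ∉ X ∧ y ∉ X ∧ X.card = 2 * N + 1 ∧
        HasPerfectTilingOn H G (insert x X) ∧
        HasPerfectTilingOn H G (insert y X)}.ncard : ℝ) := by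
  set K := 2 * N + 1 with hKdef
  have hK : Fintype.card (Fin N ⊕ Fin N ⊕ Unit) = K := by simp; omega
  set T : Finset (Fin N ⊕ Fin N ⊕ Unit → Fin n) :=
    {F | IsConnector H G k x (fun i => F (.inl i)) ∧
      IsConnector H G k y (fun i => F (.inr (.inl i))) ∧ (F (.inr (.inr ())) : ℕ) < k} with hT
  set E : Finset (Fin N ⊕ Fin N ⊕ Unit → Fin n) :=
    {F | Function.Injective F ∧ ∀ i, F i ≠ x ∧ F i ≠ y} with hE
  have hcE : (1 - δ) * (n : ℝ) ^ K ≤ #E := by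
    have := one_sub_mul_pow_le_card_injective_avoiding (n := n) (ι := Fin N ⊕ Fin N ⊕ Unit)
      (δ := δ) (by rw [hK]; exact hn) (by rw [hK]; exact hnδ) x y
    rwa [hK] at this
  have hcT : 2 * δ * (n : ℝ) ^ K ≤ #T := by
    have h1 : #((({f | IsConnector H G k x f} : Finset (Fin N → Fin n)) ×ˢ
        (({f | IsConnector H G k y f} : Finset (Fin N → Fin n)) ×ˢ
          (univ : Finset (Fin k))))) ≤ #T := by
      refine Finset.card_le_card_of_injOn
        (fun e => Sum.elim e.1 (Sum.elim e.2.1 fun _ => Fin.castLE hkn e.2.2)) ?_ ?_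
      · rintro ⟨f, g, z⟩ he
        simpa [hT] using he
      · rintro ⟨f, g, z⟩ _ ⟨f', g', z'⟩ _ he
        simp only at he
        have e1 : f = f' := funext fun i => by simpa using congrFun he (.inl i)
        have e2 : g = g' := funext fun i => by simpa using congrFun he (.inr (.inl i))
        have e3 : z = z' := by simpa using congrFun he (.inr (.inr ()))
        rw [e1, e2, e3]
    rw [Finset.card_product, Finset.card_product, Finset.card_univ, Fintype.card_fin] at h1
    calc 2 * δ * (n : ℝ) ^ K ≤ γ * γ * β * (n : ℝ) ^ K := by gcongr
      _ = γ * (n : ℝ) ^ N * (γ * (n : ℝ) ^ N * (β * n)) := by rw [hKdef]; ring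
      _ ≤ #{f : Fin N → Fin n | IsConnector H G k x f} *
          (#{f : Fin N → Fin n | IsConnector H G k y f} * (k : ℝ)) := by
        gcongr
        exacts [hγc x, hγc y]
      _ ≤ #T := by exact_mod_cast h1
  have hTE : δ * (n : ℝ) ^ K ≤ #(T ∩ E) := by
    have h1 : ((#(T ∪ E) + #(T ∩ E) : ℕ) : ℝ) = ((#T + #E : ℕ) : ℝ) := by
      rw [Finset.card_union_add_card_inter]
    have h2 : ((#(T ∪ E) : ℕ) : ℝ) ≤ (n : ℝ) ^ K := by
      have : #(T ∪ E) ≤ n ^ K := by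
        refine (Finset.card_le_univ _).trans ?_
        rw [Fintype.card_fun, hK, Fintype.card_fin]
      exact_mod_cast this
    push_cast at h1
    linarith
  have him : #((T ∩ E).image fun F => Finset.image F univ) ≤
      {X : Finset (Fin n) | x ∉ X ∧ y ∉ X ∧ X.card = K ∧
        HasPerfectTilingOn H G (insert x X) ∧ HasPerfectTilingOn H G (insert y X)}.ncard := by
    rw [← Set.ncard_coe_finset]
    refine Set.ncard_le_ncard ?_ (Set.toFinite _)
    intro X hX
    obtain ⟨F, hF, rfl⟩ := Finset.mem_image.1 (Finset.mem_coe.1 hX)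
    rw [Finset.mem_inter, hT, hE, Finset.mem_filter, Finset.mem_filter] at hF
    obtain ⟨⟨-, h1, h2, h3⟩, -, h4, h5⟩ := hF
    refine ⟨?_, ?_, ?_, hasPerfectTilingOn_of_isConnector h4 h5 h1 h2 h3⟩
    · simpa using fun i => (h5 i).1
    · simpa using fun i => (h5 i).2
    · rw [Finset.card_image_of_injective _ h4, Finset.card_univ, hK]
  have hfib := card_le_pow_mul_card_image_univ (T ∩ E)
  rw [hK] at hfib
  have hfib' : (#(T ∩ E) : ℝ) ≤ ((K : ℕ) : ℝ) ^ K *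
      {X : Finset (Fin n) | x ∉ X ∧ y ∉ X ∧ X.card = K ∧
        HasPerfectTilingOn H G (insert x X) ∧ HasPerfectTilingOn H G (insert y X)}.ncard := by
    exact_mod_cast hfib.trans (Nat.mul_le_mul_left _ him)
  have hKpos : (0 : ℝ) < (K : ℝ) ^ K := pow_pos (by exact_mod_cast Nat.succ_pos _) _
  rw [div_mul_eq_mul_div, div_le_iff₀' hKpos]
  exact hTE.trans hfib'

lemma hasTailShape_of_sOG
    (hedge : ∀ a b : Fin h, H.Adj a b → (a : ℕ) < (b : ℕ) →
      2 ≤ (a : ℕ) + 1 ∧ (a : ℕ) + 1 ≤ (h + 1) / 2 - 1 ∧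
      (h + 1) / 2 + 1 ≤ (b : ℕ) + 1 ∧ (b : ℕ) + 1 ≤ h)
    (hs1 : 1 ≤ sOG H) (hs2 : sOG H < (h + 1) / 2)
    (hind : ∀ a b : Fin h, sOG H ≤ (a : ℕ) + 1 → (a : ℕ) + 1 ≤ h - 1 →
      sOG H ≤ (b : ℕ) + 1 → (b : ℕ) + 1 ≤ h - 1 → ¬ H.Adj a b) :
    HasTailShape H ((h + 1) / 2) (sOG H) := by
  have hne : {k | ∃ a b : Fin h, H.Adj a b ∧ (a : ℕ) + 1 = k ∧ (b : ℕ) + 1 = h}.Nonempty :=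
    Nat.nonempty_of_pos_sInf hs1
  obtain ⟨a, b, hab, has, hbh⟩ := Nat.sInf_mem hne
  change (a : ℕ) + 1 = sOG H at has
  have hne' : (a : ℕ) ≠ b := fun hab' => hab.ne (Fin.ext hab')
  have hlt := hedge a b hab (by omega)
  refine ⟨by omega, hs2, by omega, fun i j hij hlt' => ?_⟩
  obtain ⟨h1, h2, h3, h4⟩ := hedge i j hij hlt'
  refine ⟨by omega, by omega, by omega, ?_⟩
  rcases lt_or_ge ((j : ℕ) + 1) h with hj | hj
  · refine Or.inl ⟨?_, hj⟩
    by_contra hi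
    exact hind i j (by omega) (by omega) (by omega) (by omega) hij
  · have hjh : (j : ℕ) + 1 = h := by omega
    exact Or.inr ⟨Nat.sInf_le ⟨i, j, hij, rfl, hjh⟩, hjh⟩

end Connecting

theorem connecting_lemma_independent_tail (h : ℕ) :
    ∃ η₀ : ℝ, 0 < η₀ ∧
      ∀ H : SimpleGraph (Fin h), intervalChi H = 2 →
      (∀ a b : Fin h, H.Adj a b → (a : ℕ) + 1 ≠ 1 ∧ (a : ℕ) + 1 ≠ (h + 1) / 2) →
      (∀ a b : Fin h, H.Adj a b → (a : ℕ) < (b : ℕ) →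
        2 ≤ (a : ℕ) + 1 ∧ (a : ℕ) + 1 ≤ (h + 1) / 2 - 1 ∧
        (h + 1) / 2 + 1 ≤ (b : ℕ) + 1 ∧ (b : ℕ) + 1 ≤ h) →
      1 ≤ sOG H → sOG H < (h + 1) / 2 →
      (∀ a b : Fin h, sOG H ≤ (a : ℕ) + 1 → (a : ℕ) + 1 ≤ h - 1 →
        sOG H ≤ (b : ℕ) + 1 → (b : ℕ) + 1 ≤ h - 1 → ¬ H.Adj a b) →
      ∀ η : ℝ, 0 < η → η ≤ η₀ →
      ∃ (n₀ : ℕ) (ξ : ℝ), 0 < ξ ∧ ∀ n : ℕ, n₀ ≤ n → ∀ G : SimpleGraph (Fin n),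
        (∀ v : Fin n, η * n ≤ (odeg G v : ℝ)) →
        ∀ x y : Fin n,
          ξ * (n : ℝ) ^ (2 * ((h + 1) / 2 - sOG H) * h - 1) ≤
            ({X : Finset (Fin n) | x ∉ X ∧ y ∉ X ∧
              X.card = 2 * ((h + 1) / 2 - sOG H) * h - 1 ∧
              HasPerfectTilingOn H G (insert x X) ∧
              HasPerfectTilingOn H G (insert y X)}.ncard : ℝ) := by
  refine ⟨1, one_pos, fun H _ _ hedge hs1 hs2 hind η hη hη1 => ?_⟩
  have hH := hasTailShape_of_sOG hedge hs1 hs2 hind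
  obtain ⟨N, hN⟩ : ∃ N, N + 1 = ((h + 1) / 2 - sOG H) * h :=
    ⟨((h + 1) / 2 - sOG H) * h - 1, Nat.sub_add_cancel (Nat.mul_pos (by omega) (by omega))⟩
  have hexp : 2 * ((h + 1) / 2 - sOG H) * h - 1 = 2 * N + 1 := by
    rw [mul_assoc, ← hN]; omega
  rw [hexp]
  set c : ℝ := η ^ 2 / 128 with hc
  set γ : ℝ := c ^ (N * N) with hγ
  set δ : ℝ := γ * γ * (η / 8) / 2 with hδ
  have hcpos : 0 < c := by positivity
  have hγpos : 0 < γ := by positivity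
  have hδpos : 0 < δ := by positivity
  have hc1 : c ≤ 1 := by rw [hc]; nlinarith
  set n₁ : ℕ := ⌈((2 * N + 1 : ℕ) * ((2 * N + 1 : ℕ) + 1 : ℝ)) / δ⌉₊
  refine ⟨max (2 * N + 2) (max n₁ ⌈8 / η⌉₊),
    δ / ((2 * N + 1 : ℕ) : ℝ) ^ (2 * N + 1), by positivity, fun n hn G hdeg x y => ?_⟩
  have hn1 : 2 * N + 2 ≤ n := (le_max_left _ _).trans hn
  have hn2 : n₁ ≤ n := (le_max_left _ _).trans ((le_max_right _ _).trans hn)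
  have hn3 : ⌈8 / η⌉₊ ≤ n := (le_max_right _ _).trans ((le_max_right _ _).trans hn)
  have hn2' := Nat.ceil_le.1 hn2
  have hn3' := Nat.ceil_le.1 hn3
  rw [div_le_iff₀' hδpos] at hn2'
  rw [div_le_iff₀' hη] at hn3'
  set k : ℕ := ⌊η * n / 4⌋₊ with hk
  have hk1 : (k : ℝ) ≤ η * n / 4 := Nat.floor_le (by positivity)
  have hk2 : η * n / 4 < k + 1 := Nat.lt_floor_add_one _
  have hk3 : η / 8 * n ≤ k := by linarith
  have hk4 : 1 ≤ k := by
    have : (0 : ℝ) < k := by linarith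
    exact_mod_cast this
  have hkn : k ≤ n := by
    have : (k : ℝ) ≤ n := by nlinarith [Nat.cast_nonneg (α := ℝ) n]
    exact_mod_cast this
  refine le_ncard_of_le_card_isConnector (k := k) (γ := γ) (β := η / 8) hγpos.le (by positivity)
    (by rw [hδ]; linarith) (fun x => ?_) hk3 hkn (by exact_mod_cast hn1) hn2' x y
  refine hH.le_card_isConnector hN hk4 (fun v => ?_) hcpos.le hc1 ?_ x
  · have : ((4 * k : ℕ) : ℝ) ≤ odeg G v := by
      push_cast
      linarith [hdeg v]
    exact_mod_cast this
  · calc 2 * (c * (n : ℝ) ^ 2) = (η / 8 * n) ^ 2 := by rw [hc]; ring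
      _ ≤ (k : ℝ) ^ 2 := by gcongr
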